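/- arXiv:2409.07395 — 3 statements merged into one kernel-verified Lean document; each statement's English description precedes it below -/
import Mathlib

section
/- Let μ be a Radon measure on ℝ^{n+m} (a Borel measure finite on compact sets), let 1 < p < ∞ and γ > 0, let α + β = 1 with β ≤ 0, and let α′ + β′ = 1 with 0 ≤ α′ < 1. Let f ∈ L¹_loc(ℝ^{n+m},μ) and, for each dyadic rectangle R, set a(f)_R = ℓ_{α,β}(R)^{γ/p} (1/μ(R)) ∫_R f dμ when μ(R) > 0 and a(f)_R = 0 otherwise. Then there is a constant C such that (sup_{λ>0} λᵖ ∑_{R : |a(f)_R| > λ} ℓ_{α′,β′}(R)^{−γ} μ(R))^{1/p} ≤ C · ‖f‖_{Lᵖ(ℝ^{n+m},μ)}, where the sum runs over all dyadic rectangles R of ℝ^{n+m}. -/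
open MeasureTheory Set
open scoped ENNReal Classical

noncomputable section

/-- The half-open dyadic cube in `ℝⁿ` of generation `k` (sidelength `2 ^ k`) and
corner index `j`. -/
def dyadicCube (n : ℕ) (k : ℤ) (j : Fin n → ℤ) : Set (Fin n → ℝ) :=
  Set.univ.pi fun i => Set.Ico ((j i : ℝ) * 2 ^ k) (((j i : ℝ) + 1) * 2 ^ k)

/-- The dyadic rectangle `Q₁ × Q₂ ⊂ ℝⁿ × ℝᵐ` indexed by `R = ((k₁, j₁), (k₂, j₂))`. -/
def dyadicRect (n m : ℕ) (R : (ℤ × (Fin n → ℤ)) × (ℤ × (Fin m → ℤ))) :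
    Set ((Fin n → ℝ) × (Fin m → ℝ)) :=
  (dyadicCube n R.1.1 R.1.2) ×ˢ (dyadicCube m R.2.1 R.2.2)

/-- The mean sidelength `ℓ_{α,β}(R) = ℓ_min(R)^α ℓ_max(R)^β` of the dyadic rectangle
indexed by `R`, whose sidelengths are `2 ^ R.1.1` and `2 ^ R.2.1`. -/
def lMean (n m : ℕ) (R : (ℤ × (Fin n → ℤ)) × (ℤ × (Fin m → ℤ))) (α β : ℝ) : ℝ :=
  (min ((2 : ℝ) ^ R.1.1) ((2 : ℝ) ^ R.2.1)) ^ α *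
    (max ((2 : ℝ) ^ R.1.1) ((2 : ℝ) ^ R.2.1)) ^ β

/-- Truncated geometric series over `ℤ`: the terms `l * r ^ (-k)` lying below `u`, raised to a
positive power `q`, sum to at most a constant times `u ^ q`. -/
theorem tsum_truncated_geometric_le {r q l u : ℝ} (hr : 1 < r) (hl : 0 < l) (hq : 0 < q)
    (hu : 0 ≤ u) :
    (∑' k : ℤ, if l * r ^ (-(k : ℝ)) < u then ENNReal.ofReal ((l * r ^ (-(k : ℝ))) ^ q) else 0)
      ≤ ENNReal.ofReal (u ^ q) * (1 - ENNReal.ofReal (r ^ (-q)))⁻¹ := by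
  have hr0 : 0 < r := one_pos.trans hr
  rcases hu.eq_or_lt with rfl | hu
  · have h : ∀ k : ℤ, ¬ l * r ^ (-(k : ℝ)) < 0 := fun k => not_lt.2 (by positivity)
    simp [h]
  obtain ⟨N, hN1, hN2⟩ := exists_mem_Ico_zpow (div_pos hl hu) hr
  have hlt : ∀ k : ℤ, l * r ^ (-(k : ℝ)) < u ↔ l / u < r ^ k := by
    intro k
    have hk : 0 < r ^ k := by positivity
    rw [Real.rpow_neg hr0.le, Real.rpow_intCast, ← div_eq_mul_inv, div_lt_iff₀ hk,
      div_lt_iff₀ hu, mul_comm]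
  have hinj : Function.Injective (fun j : ℕ => N + 1 + (j : ℤ)) := fun a b h => by
    simpa using h
  rw [← hinj.tsum_eq]
  · rw [← ENNReal.tsum_geometric, ← ENNReal.tsum_mul_left]
    refine ENNReal.tsum_le_tsum fun j => ?_
    have hsmall : l * r ^ (-((N + 1 : ℤ) : ℝ)) < u := (hlt _).2 hN2
    split_ifs
    · rw [← ENNReal.ofReal_pow (by positivity), ← ENNReal.ofReal_mul (by positivity)]
      apply ENNReal.ofReal_le_ofReal
      have hsplit : l * r ^ (-((N + 1 + (j : ℤ) : ℤ) : ℝ))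
          = (l * r ^ (-((N + 1 : ℤ) : ℝ))) * r ^ (-(j : ℝ)) := by
        rw [mul_assoc, ← Real.rpow_add hr0]
        congr 2
        push_cast
        ring
      have hpow : (r ^ (-(j : ℝ))) ^ q = (r ^ (-q)) ^ j := by
        rw [← Real.rpow_natCast, ← Real.rpow_mul hr0.le, ← Real.rpow_mul hr0.le]
        congr 1
        ring
      rw [hsplit, Real.mul_rpow (by positivity) (by positivity), hpow]
      gcongr
    · exact zero_le
  · intro k hk
    have hk' : l * r ^ (-(k : ℝ)) < u := by
      by_contra h
      exact hk (if_neg h)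
    have hNk : N < k := (zpow_lt_zpow_iff_right₀ hr).1 (hN1.trans_lt ((hlt k).1 hk'))
    exact ⟨(k - (N + 1)).toNat, by simp only; omega⟩

/-- If the average of `f` over `S` exceeds `t`, then the part of `f` above `t / 2` carries at least
half of the mass `t * μ S`. -/
theorem mul_measure_le_of_lt_abs_average {X : Type*} [MeasurableSpace X] {μ : Measure X}
    {S : Set X} {f : X → ℝ} {t : ℝ} (ht : 0 < t) (h : t < |⨍ z in S, f z ∂μ|) :
    ENNReal.ofReal t * μ S
      ≤ 2 * ∫⁻ z in S, (if t < 2 * |f z| then ENNReal.ofReal |f z| else 0) ∂μ := by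
  rw [setAverage_eq, smul_eq_mul, abs_mul, abs_of_nonneg (by positivity)] at h
  have hS : 0 < μ.real S := by
    rcases (measureReal_nonneg (μ := μ) (s := S)).eq_or_lt with h0 | h0
    · rw [← h0] at h
      simp only [inv_zero, zero_mul] at h
      exact absurd h ht.not_gt
    · exact h0
  have hfin : μ S ≠ ∞ := fun htop => by simp [measureReal_def, htop] at hS
  rw [inv_mul_eq_div, lt_div_iff₀ hS] at h
  have hle : ENNReal.ofReal t * μ S ≤ ∫⁻ z in S, ENNReal.ofReal |f z| ∂μ := by
    calc ENNReal.ofReal t * μ S = ENNReal.ofReal (t * μ.real S) := by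
          rw [ENNReal.ofReal_mul ht.le, ofReal_measureReal hfin]
      _ ≤ ENNReal.ofReal |∫ z in S, f z ∂μ| := ENNReal.ofReal_le_ofReal h.le
      _ ≤ _ := by
          simp_rw [← Real.enorm_eq_ofReal_abs]
          exact enorm_integral_le_lintegral_enorm _
  have hsplit : ∫⁻ z in S, ENNReal.ofReal |f z| ∂μ ≤ ENNReal.ofReal (t / 2) * μ S
      + ∫⁻ z in S, (if t < 2 * |f z| then ENNReal.ofReal |f z| else 0) ∂μ := by
    rw [← setLIntegral_const, ← lintegral_add_left measurable_const]
    refine lintegral_mono fun z => ?_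
    simp only
    split_ifs with hz
    · exact le_add_self
    · rw [add_zero]
      exact ENNReal.ofReal_le_ofReal (by linarith)
  have hhalf : ENNReal.ofReal t * μ S
      = ENNReal.ofReal (t / 2) * μ S + ENNReal.ofReal (t / 2) * μ S := by
    rw [← add_mul, ← ENNReal.ofReal_add (by positivity) (by positivity), add_halves]
  have hkey := hle.trans hsplit
  rw [hhalf] at hkey
  have := (ENNReal.add_le_add_iff_left (ENNReal.mul_ne_top ENNReal.ofReal_ne_top hfin)).1 hkey
  rw [hhalf, ← two_mul]
  gcongr

theorem measurableSet_dyadicCube (n : ℕ) (k : ℤ) (j : Fin n → ℤ) :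
    MeasurableSet (dyadicCube n k j) :=
  MeasurableSet.univ_pi fun _ => measurableSet_Ico

theorem measurableSet_dyadicRect (n m : ℕ) (R : (ℤ × (Fin n → ℤ)) × (ℤ × (Fin m → ℤ))) :
    MeasurableSet (dyadicRect n m R) :=
  (measurableSet_dyadicCube _ _ _).prod (measurableSet_dyadicCube _ _ _)

theorem eq_floor_of_mem_dyadicCube {n : ℕ} {k : ℤ} {j : Fin n → ℤ} {x : Fin n → ℝ}
    (hx : x ∈ dyadicCube n k j) : j = fun i => ⌊x i / 2 ^ k⌋ := by
  funext i
  have h2 : (0 : ℝ) < 2 ^ k := by positivity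
  obtain ⟨h₁, h₂⟩ := hx i (mem_univ i)
  exact (Int.floor_eq_iff.2 ⟨(le_div_iff₀ h2).2 h₁, (div_lt_iff₀ h2).2 h₂⟩).symm

/-- Dyadic rectangles with fixed sidelengths are pairwise disjoint. -/
theorem pairwise_disjoint_dyadicRect (n m : ℕ) (k : ℤ × ℤ) :
    Pairwise (Function.onFun Disjoint fun j : (Fin n → ℤ) × (Fin m → ℤ) =>
      dyadicRect n m ((k.1, j.1), (k.2, j.2))) := by
  intro j j' hne
  refine Set.disjoint_left.2 fun z hz hz' => hne ?_
  exact Prod.ext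
    ((eq_floor_of_mem_dyadicCube hz.1).trans (eq_floor_of_mem_dyadicCube hz'.1).symm)
    ((eq_floor_of_mem_dyadicCube hz.2).trans (eq_floor_of_mem_dyadicCube hz'.2).symm)

theorem lMean_eq_two_rpow (n m : ℕ) (R : (ℤ × (Fin n → ℤ)) × (ℤ × (Fin m → ℤ))) {α β : ℝ}
    (h : α + β = 1) :
    lMean n m R α β = 2 ^ (((min R.1.1 R.2.1 : ℤ) : ℝ) + β * |((R.1.1 - R.2.1 : ℤ) : ℝ)|) := by
  have hmono : Monotone fun k : ℤ => (2 : ℝ) ^ k := zpow_right_mono₀ one_le_two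
  have hmin := hmono.map_min (a := R.1.1) (b := R.2.1)
  have hmax := hmono.map_max (a := R.1.1) (b := R.2.1)
  rw [lMean, ← hmin, ← hmax, ← Real.rpow_intCast, ← Real.rpow_intCast,
    ← Real.rpow_mul zero_le_two, ← Real.rpow_mul zero_le_two, ← Real.rpow_add two_pos]
  obtain rfl : α = 1 - β := by linarith
  congr 1
  rcases le_total R.1.1 R.2.1 with hle | hle
  · have : ((R.1.1 : ℤ) : ℝ) ≤ R.2.1 := by exact_mod_cast hle
    rw [min_eq_left hle, max_eq_right hle, abs_of_nonpos (by push_cast; linarith)]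
    push_cast
    ring
  · have : ((R.2.1 : ℤ) : ℝ) ≤ R.1.1 := by exact_mod_cast hle
    rw [min_eq_right hle, max_eq_left hle, abs_of_nonneg (by push_cast; linarith)]
    push_cast
    ring

theorem lMean_rpow_le {n m : ℕ} (R : (ℤ × (Fin n → ℤ)) × (ℤ × (Fin m → ℤ))) {α β c : ℝ}
    (h : α + β = 1) (hβ : β ≤ 0) (hc : 0 ≤ c) :
    lMean n m R α β ^ c ≤ ((2 : ℝ) ^ c) ^ ((min R.1.1 R.2.1 : ℤ) : ℝ) := by
  rw [lMean_eq_two_rpow n m R h, ← Real.rpow_mul zero_le_two, ← Real.rpow_mul zero_le_two]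
  apply Real.rpow_le_rpow_of_exponent_le one_le_two
  rw [mul_comm c]
  gcongr
  nlinarith [abs_nonneg ((R.1.1 - R.2.1 : ℤ) : ℝ)]

theorem mul_lMean_rpow_eq {n m : ℕ} (R : (ℤ × (Fin n → ℤ)) × (ℤ × (Fin m → ℤ)))
    {α β γ p l : ℝ} (h : α + β = 1) (hp : 0 < p) (hl : 0 ≤ l) :
    l ^ p * lMean n m R α β ^ (-γ)
      = (2 : ℝ) ^ (-(β * γ) * |((R.1.1 - R.2.1 : ℤ) : ℝ)|) *
        (l * ((2 : ℝ) ^ (γ / p)) ^ (-((min R.1.1 R.2.1 : ℤ) : ℝ))) ^ p := by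
  rw [lMean_eq_two_rpow n m R h, Real.mul_rpow hl (by positivity), mul_left_comm,
    ← Real.rpow_mul zero_le_two, ← Real.rpow_mul zero_le_two, ← Real.rpow_mul zero_le_two,
    ← Real.rpow_add two_pos]
  congr 2
  field_simp
  ring

theorem tsum_two_rpow_neg_mul_abs_ne_top {c : ℝ} (hc : 0 < c) :
    ∑' s : ℤ, ENNReal.ofReal ((2 : ℝ) ^ (-c * |(s : ℝ)|)) ≠ ∞ := by
  have hlt : (2 : ℝ) ^ (-c) < 1 := Real.rpow_lt_one_of_one_lt_of_neg one_lt_two (by linarith)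
  have hgeo : Summable fun j : ℕ => (2 : ℝ) ^ (-c * (j : ℝ)) := by
    refine (summable_geometric_of_lt_one (by positivity) hlt).congr fun j => ?_
    rw [Real.rpow_mul zero_le_two, Real.rpow_natCast]
  have hsum : Summable fun s : ℤ => (2 : ℝ) ^ (-c * |(s : ℝ)|) := by
    apply Summable.of_nat_of_neg <;> simpa using hgeo
  rw [← ENNReal.ofReal_tsum_of_nonneg (fun _ => by positivity) hsum]
  exact ENNReal.ofReal_ne_top

/-- The contribution of a single dyadic rectangle is controlled by the part of `f` above the
threshold associated with its shorter side. -/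
theorem dyadicRect_term_le {n m : ℕ} {p γ α β α' β' l : ℝ} (hp : 0 < p) (hγ : 0 < γ)
    (hαβ : α + β = 1) (hβ : β ≤ 0) (hα'β' : α' + β' = 1) (hl : 0 < l)
    (μ : Measure ((Fin n → ℝ) × (Fin m → ℝ))) (f : (Fin n → ℝ) × (Fin m → ℝ) → ℝ)
    (R : (ℤ × (Fin n → ℤ)) × (ℤ × (Fin m → ℤ))) {t : ℝ}
    (ht : t = l * ((2 : ℝ) ^ (γ / p)) ^ (-((min R.1.1 R.2.1 : ℤ) : ℝ))) :
    (ENNReal.ofReal (l ^ p) *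
      if l < |lMean n m R α β ^ (γ / p) * ⨍ z in dyadicRect n m R, f z ∂μ| then
        ENNReal.ofReal (lMean n m R α' β' ^ (-γ)) * μ (dyadicRect n m R) else 0)
      ≤ ENNReal.ofReal ((2 : ℝ) ^ (-(β' * γ) * |((R.1.1 - R.2.1 : ℤ) : ℝ)|)) *
        (2 * ENNReal.ofReal (t ^ (p - 1)) *
        ∫⁻ z in dyadicRect n m R, (if t < 2 * |f z| then ENNReal.ofReal |f z| else 0) ∂μ) := by
  have ht0 : 0 < t := by rw [ht]; positivity
  split_ifs with hR
  · have hpos : 0 < ((2 : ℝ) ^ (γ / p)) ^ ((min R.1.1 R.2.1 : ℤ) : ℝ) := by positivity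
    have hlM : 0 ≤ lMean n m R α β ^ (γ / p) := by
      rw [lMean_eq_two_rpow n m R hαβ]
      positivity
    have hav : t < |⨍ z in dyadicRect n m R, f z ∂μ| := by
      rw [abs_mul, abs_of_nonneg hlM] at hR
      rw [ht, Real.rpow_neg (by positivity), ← div_eq_mul_inv, div_lt_iff₀ hpos, mul_comm]
      exact hR.trans_le (mul_le_mul_of_nonneg_right
        (lMean_rpow_le R hαβ hβ (by positivity)) (abs_nonneg _))
    have htp : t ^ p = t ^ (p - 1) * t := by
      rw [Real.rpow_sub_one ht0.ne', div_mul_cancel₀ _ ht0.ne']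
    rw [← mul_assoc, ← ENNReal.ofReal_mul (by positivity), mul_lMean_rpow_eq R hα'β' hp hl.le,
      ← ht, htp, ENNReal.ofReal_mul (by positivity), ENNReal.ofReal_mul (by positivity),
      mul_assoc, mul_assoc, mul_comm (2 : ℝ≥0∞), mul_assoc]
    exact mul_le_mul' le_rfl (mul_le_mul' le_rfl (mul_measure_le_of_lt_abs_average ht0 hav))
  · simp

/-- Summation over all dyadic rectangles, for a fixed level `l`. -/
theorem tsum_dyadicRect_le {n m : ℕ} {p γ α β α' β' l : ℝ} (hp : 1 < p) (hγ : 0 < γ)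
    (hαβ : α + β = 1) (hβ : β ≤ 0) (hα'β' : α' + β' = 1) (hl : 0 < l)
    (μ : Measure ((Fin n → ℝ) × (Fin m → ℝ))) {f : (Fin n → ℝ) × (Fin m → ℝ) → ℝ}
    (hf : AEMeasurable f μ) :
    ENNReal.ofReal (l ^ p) *
      ∑' R : (ℤ × (Fin n → ℤ)) × (ℤ × (Fin m → ℤ)),
        (if l < |lMean n m R α β ^ (γ / p) * ⨍ z in dyadicRect n m R, f z ∂μ| then
          ENNReal.ofReal (lMean n m R α' β' ^ (-γ)) * μ (dyadicRect n m R) else 0)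
      ≤ (∑' s : ℤ, ENNReal.ofReal ((2 : ℝ) ^ (-(β' * γ) * |(s : ℝ)|))) *
          (ENNReal.ofReal (2 ^ p) * (1 - ENNReal.ofReal (((2 : ℝ) ^ (γ / p)) ^ (-(p - 1))))⁻¹) *
          ∫⁻ z, ENNReal.ofReal (|f z| ^ p) ∂μ := by
  have hp0 : 0 < p := one_pos.trans hp
  set r : ℝ := (2 : ℝ) ^ (γ / p)
  have hr1 : 1 < r := Real.one_lt_rpow one_lt_two (by positivity)
  set w : ℤ → ℝ≥0∞ := fun s => ENNReal.ofReal ((2 : ℝ) ^ (-(β' * γ) * |(s : ℝ)|))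
  set B : ℝ≥0∞ := (1 - ENNReal.ofReal (r ^ (-(p - 1))))⁻¹
  let t : ℤ → ℝ := fun k => l * r ^ (-(k : ℝ))
  let h : ℤ → (Fin n → ℝ) × (Fin m → ℝ) → ℝ≥0∞ := fun k z =>
    if t k < 2 * |f z| then ENNReal.ofReal |f z| else 0
  have hh : ∀ k, AEMeasurable (h k) μ := fun k => by
    have : Measurable fun y : ℝ => if t k < 2 * |y| then ENNReal.ofReal |y| else 0 :=
      Measurable.ite (measurableSet_lt measurable_const (by fun_prop)) (by fun_prop)
        measurable_const
    exact this.comp_aemeasurable hf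
  let Φ : ℤ × ℤ → ℝ≥0∞ := fun q =>
    w q.2 * (2 * ENNReal.ofReal (t q.1 ^ (p - 1)) * ∫⁻ z, h q.1 z ∂μ)
  let e : (ℤ × ℤ) × ((Fin n → ℤ) × (Fin m → ℤ)) ≃ (ℤ × (Fin n → ℤ)) × (ℤ × (Fin m → ℤ)) :=
    Equiv.prodProdProdComm _ _ _ _
  have hinj : Function.Injective fun k : ℤ × ℤ => (min k.1 k.2, k.1 - k.2) := by
    rintro ⟨a, b⟩ ⟨c, d⟩ hq
    simp only [Prod.mk.injEq] at hq ⊢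
    omega
  have hpoint : ∀ z, ∑' k : ℤ, 2 * ENNReal.ofReal (t k ^ (p - 1)) * h k z
      ≤ ENNReal.ofReal (2 ^ p) * B * ENNReal.ofReal (|f z| ^ p) := by
    intro z
    have hgeo := tsum_truncated_geometric_le (q := p - 1) (u := 2 * |f z|) hr1 hl (by linarith)
      (by positivity)
    have hterm : ∀ k, 2 * ENNReal.ofReal (t k ^ (p - 1)) * h k z
        = ENNReal.ofReal (2 * |f z|) *
          if l * r ^ (-(k : ℝ)) < 2 * |f z| then
            ENNReal.ofReal ((l * r ^ (-(k : ℝ))) ^ (p - 1)) else 0 := by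
      intro k
      simp only [h, t]
      split_ifs
      · rw [ENNReal.ofReal_mul zero_le_two, ENNReal.ofReal_ofNat]
        ring
      · simp
    have hpow : 2 * |f z| * (2 * |f z|) ^ (p - 1) = 2 ^ p * |f z| ^ p := by
      rw [← Real.mul_rpow zero_le_two (abs_nonneg _), ← Real.rpow_one_add' (by positivity)
        (by linarith)]
      congr 1
      ring
    simp_rw [hterm]
    rw [ENNReal.tsum_mul_left]
    refine (mul_le_mul_right hgeo _).trans_eq ?_
    rw [← mul_assoc, ← ENNReal.ofReal_mul (by positivity), hpow,
      ENNReal.ofReal_mul (by positivity), mul_right_comm]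
  rw [← ENNReal.tsum_mul_left, ← e.tsum_eq]
  calc _ ≤ ∑' c : (ℤ × ℤ) × ((Fin n → ℤ) × (Fin m → ℤ)),
          w (c.1.1 - c.1.2) * (2 * ENNReal.ofReal (t (min c.1.1 c.1.2) ^ (p - 1)) *
            ∫⁻ z in dyadicRect n m ((c.1.1, c.2.1), (c.1.2, c.2.2)), h (min c.1.1 c.1.2) z ∂μ) :=
        ENNReal.tsum_le_tsum fun c =>
          dyadicRect_term_le hp0 hγ hαβ hβ hα'β' hl μ f (e c) rfl
    _ ≤ ∑' k : ℤ × ℤ, Φ (min k.1 k.2, k.1 - k.2) := by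
        rw [ENNReal.tsum_prod']
        refine ENNReal.tsum_le_tsum fun k => ?_
        simp_rw [ENNReal.tsum_mul_left]
        rw [← lintegral_iUnion (fun _ => measurableSet_dyadicRect n m _)
          (pairwise_disjoint_dyadicRect n m k)]
        exact mul_le_mul' le_rfl <| mul_le_mul' le_rfl <| setLIntegral_le_lintegral _ _
    _ ≤ ∑' q : ℤ × ℤ, Φ q := ENNReal.tsum_comp_le_tsum_of_injective hinj Φ
    _ = (∑' s, w s) * ∫⁻ z, ∑' k, 2 * ENNReal.ofReal (t k ^ (p - 1)) * h k z ∂μ := by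
        rw [lintegral_tsum fun k => (hh k).const_mul _, ENNReal.tsum_prod', ENNReal.tsum_comm]
        simp_rw [Φ, ENNReal.tsum_mul_left, ENNReal.tsum_mul_right]
        congr 2
        funext k
        rw [lintegral_const_mul'' _ (hh k)]
    _ ≤ (∑' s, w s) * ∫⁻ z, ENNReal.ofReal (2 ^ p) * B * ENNReal.ofReal (|f z| ^ p) ∂μ := by
        gcongr with z
        exact hpoint z
    _ = _ := by
        have : AEMeasurable (fun z => ENNReal.ofReal (|f z| ^ p)) μ := by fun_prop
        rw [lintegral_const_mul'' _ this, ← mul_assoc]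

/-- bi-parameter weak-type embedding of `L^p`.  For a Radon measure `μ` on
`ℝ^{n+m}`, `1 < p < ∞`, `γ > 0`, `α + β = 1` with `β ≤ 0`, `α' + β' = 1` with
`0 ≤ α' < 1`, `f ∈ L¹_loc(μ)` and `a(f)_R = ℓ_{α,β}(R)^{γ/p} ⨍_R f dμ` (which is `0`
when `μ(R) = 0`), one has
`(sup_{λ>0} λ^p ∑_{|a(f)_R|>λ} ℓ_{α',β'}(R)^{-γ} μ(R))^{1/p} ≤ C ‖f‖_{L^p(μ)}`. -/
theorem statement12 (n m : ℕ) (p γ α β α' β' : ℝ) (hp : 1 < p) (hγ : 0 < γ)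
    (hαβ : α + β = 1) (hβ : β ≤ 0) (hα'β' : α' + β' = 1) (hα'0 : 0 ≤ α') (hα'1 : α' < 1) :
    ∃ C : ℝ, 0 < C ∧
      ∀ (μ : Measure ((Fin n → ℝ) × (Fin m → ℝ))), IsFiniteMeasureOnCompacts μ →
      ∀ f : (Fin n → ℝ) × (Fin m → ℝ) → ℝ, LocallyIntegrable f μ →
      (⨆ l ∈ Set.Ioi (0 : ℝ), ENNReal.ofReal (l ^ p) *
          ∑' R : (ℤ × (Fin n → ℤ)) × (ℤ × (Fin m → ℤ)),
            if l < |lMean n m R α β ^ (γ / p) * ⨍ z in dyadicRect n m R, f z ∂μ| then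
              ENNReal.ofReal (lMean n m R α' β' ^ (-γ)) * μ (dyadicRect n m R) else 0)
          ^ (1 / p)
        ≤ ENNReal.ofReal C * (∫⁻ z, ENNReal.ofReal (|f z| ^ p) ∂μ) ^ (1 / p) := by
  have hp0 : 0 < p := one_pos.trans hp
  have hβ' : 0 < β' := by linarith
  set K : ℝ≥0∞ := (∑' s : ℤ, ENNReal.ofReal ((2 : ℝ) ^ (-(β' * γ) * |(s : ℝ)|))) *
    (ENNReal.ofReal (2 ^ p) * (1 - ENNReal.ofReal (((2 : ℝ) ^ (γ / p)) ^ (-(p - 1))))⁻¹)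
  have hratio : ((2 : ℝ) ^ (γ / p)) ^ (-(p - 1)) < 1 :=
    Real.rpow_lt_one_of_one_lt_of_neg (Real.one_lt_rpow one_lt_two (by positivity)) (by linarith)
  have hKtop : K ≠ ∞ := by
    refine ENNReal.mul_ne_top (tsum_two_rpow_neg_mul_abs_ne_top (by positivity))
      (ENNReal.mul_ne_top ENNReal.ofReal_ne_top (ENNReal.inv_ne_top.2 ?_))
    exact (tsub_pos_of_lt (ENNReal.ofReal_lt_one.2 hratio)).ne'
  have hKp : K ^ (1 / p) ≠ ∞ := ENNReal.rpow_ne_top_of_nonneg (by positivity) hKtop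
  refine ⟨(K ^ (1 / p)).toReal + 1, by positivity, fun μ _ f hf => ?_⟩
  have hfm : AEMeasurable f μ := hf.aestronglyMeasurable.aemeasurable
  calc _ ≤ (K * ∫⁻ z, ENNReal.ofReal (|f z| ^ p) ∂μ) ^ (1 / p) := by
        refine ENNReal.rpow_le_rpow (iSup₂_le fun l hl => ?_) (by positivity)
        exact tsum_dyadicRect_le hp hγ hαβ hβ hα'β' hl μ hfm
    _ = K ^ (1 / p) * (∫⁻ z, ENNReal.ofReal (|f z| ^ p) ∂μ) ^ (1 / p) :=
        ENNReal.mul_rpow_of_nonneg _ _ (by positivity)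
    _ ≤ _ := by
        gcongr
        exact ENNReal.le_ofReal_iff_toReal_le hKp (by positivity) |>.2 (by linarith)
end
end

section
/- Let 1 ≤ p < ∞ and let f ∈ L¹_loc(ℝⁿ) (with respect to Lebesgue measure). Define m(f)(x,r) = O(f,B(x,r)) for (x,r) ∈ ℝⁿ × (0,∞), and let ν_p be the measure on ℝⁿ × (0,∞) given by dν_p = dx dr / r^{p+1}. Then there is a constant C = C(n,p) such that sup_{λ>0} λᵖ ∑_{Q∈𝒟 : O(f,Q) > λ} ℓ(Q)^{−p} |Q| ≤ C · sup_{λ>0} λᵖ ν_p({(x,r) ∈ ℝⁿ×(0,∞) : m(f)(x,r) > λ}), i.e. ‖f‖_{𝒪ᵖ(ℝⁿ)} ≲ ‖m(f)‖_{L^{p,∞}(ℝ^{n+1}₊, ν_p)}. -/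
open MeasureTheory Set
open scoped ENNReal Classical

noncomputable section

/-- The open Euclidean ball of center `x` and radius `t` in `ℝⁿ`. -/
def eBall {n : ℕ} (x : Fin n → ℝ) (t : ℝ) : Set (Fin n → ℝ) :=
  {y | ∑ i, (y i - x i) ^ 2 < t ^ 2}

/-- The mean oscillation `O(f,E) = ⨍_E |f - ⨍_E f|` (w.r.t. Lebesgue measure). -/
def osc {n : ℕ} (f : (Fin n → ℝ) → ℝ) (E : Set (Fin n → ℝ)) : ℝ :=
  ⨍ x in E, |f x - ⨍ y in E, f y|

/-- The measure `ν_p` on `ℝⁿ × (0,∞)` given by `dν_p = dx dr / r^{p+1}`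
(realized on `ℝⁿ × ℝ`; only sets of points with positive last coordinate are used). -/
def nuP (n : ℕ) (p : ℝ) : Measure ((Fin n → ℝ) × ℝ) :=
  (volume.prod volume).withDensity fun z => ENNReal.ofReal (z.2 ^ (-(p + 1)))

/-- Mean oscillation is quasi-monotone along inclusions of sets of comparable measure. -/
theorem osc_le_of_subset {n : ℕ} {f : (Fin n → ℝ) → ℝ} {A B : Set (Fin n → ℝ)} {K : ℝ}
    (hAB : A ⊆ B) (hA : 0 < volume.real A) (hB : volume B ≠ ∞)
    (hK : volume.real B ≤ K * volume.real A) (hf : IntegrableOn f B volume) :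
    osc f A ≤ 2 * K * osc f B := by
  have hAfin : volume A ≠ ∞ := measure_ne_top_of_subset hAB hB
  have hBpos : 0 < volume.real B := hA.trans_le (measureReal_mono hAB hB)
  set b : ℝ := ⨍ y in B, f y with hb
  set a : ℝ := ⨍ y in A, f y with ha
  have hfb : IntegrableOn (fun x => f x - b) B volume :=
    hf.sub (integrableOn_const hB)
  have hfbA := hfb.mono_set hAB
  have hfaA : IntegrableOn (fun x => f x - a) A volume :=
    (hf.mono_set hAB).sub (integrableOn_const hAfin)
  have hmono : ∫ x in A, |f x - b| ≤ ∫ x in B, |f x - b| :=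
    setIntegral_mono_set hfb.abs (Filter.Eventually.of_forall fun x => abs_nonneg _)
      (Filter.Eventually.of_forall hAB)
  have hmean : volume.real A * |b - a| ≤ ∫ x in A, |f x - b| := by
    have h1 : ∫ x in A, (f x - b) = volume.real A * (a - b) := by
      rw [integral_sub (hf.mono_set hAB) (integrableOn_const hAfin), setIntegral_const, ha,
        setAverage_eq, smul_eq_mul, smul_eq_mul]
      field_simp
    calc volume.real A * |b - a| = |∫ x in A, (f x - b)| := by
          rw [h1, abs_mul, abs_of_pos hA, abs_sub_comm]
      _ ≤ _ := abs_integral_le_integral_abs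
  have htri : ∫ x in A, |f x - a| ≤ (∫ x in A, |f x - b|) + volume.real A * |b - a| := by
    have hc : IntegrableOn (fun _ : Fin n → ℝ => |b - a|) A volume := integrableOn_const hAfin
    calc ∫ x in A, |f x - a| ≤ ∫ x in A, (|f x - b| + |b - a|) :=
          integral_mono hfaA.abs (hfbA.abs.add hc) fun x => abs_sub_le _ _ _
      _ = _ := by
          rw [integral_add hfbA.abs hc, setIntegral_const, smul_eq_mul]
  have hI : 0 ≤ ∫ x in B, |f x - b| := integral_nonneg fun x => abs_nonneg _
  have hmain : ∫ x in A, |f x - a| ≤ 2 * ∫ x in B, |f x - b| := by linarith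
  have hratio : (volume.real A)⁻¹ ≤ K * (volume.real B)⁻¹ := by
    rw [← div_eq_mul_inv, le_div_iff₀ hBpos, inv_mul_le_iff₀ hA]
    linarith
  unfold osc
  rw [← ha, ← hb, setAverage_eq, setAverage_eq, smul_eq_mul, smul_eq_mul]
  calc (volume.real A)⁻¹ * ∫ x in A, |f x - a|
      ≤ (volume.real A)⁻¹ * (2 * ∫ x in B, |f x - b|) := by gcongr
    _ ≤ (K * (volume.real B)⁻¹) * (2 * ∫ x in B, |f x - b|) := by gcongr
    _ = _ := by ring

theorem volume_dyadicCube (n : ℕ) (k : ℤ) (j : Fin n → ℤ) :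
    volume (dyadicCube n k j) = ENNReal.ofReal (((2 : ℝ) ^ k) ^ n) := by
  unfold dyadicCube
  rw [Real.volume_pi_Ico, ENNReal.ofReal_pow (by positivity)]
  simp [← sub_mul]

theorem volume_real_dyadicCube (n : ℕ) (k : ℤ) (j : Fin n → ℤ) :
    volume.real (dyadicCube n k j) = ((2 : ℝ) ^ k) ^ n := by
  rw [measureReal_def, volume_dyadicCube, ENNReal.toReal_ofReal (by positivity)]

theorem dyadicCube_subset_eBall {n : ℕ} {k : ℤ} {j : Fin n → ℤ} {x : Fin n → ℝ} {r : ℝ}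
    (hx : x ∈ dyadicCube n k j) (hr : ((n : ℝ) + 1) * 2 ^ k ≤ r) :
    dyadicCube n k j ⊆ eBall x r := by
  intro y hy
  have h2 : (0 : ℝ) < 2 ^ k := by positivity
  have hle : ∑ i, (y i - x i) ^ 2 ≤ ∑ _i : Fin n, ((2 : ℝ) ^ k) ^ 2 := by
    refine Finset.sum_le_sum fun i _ => ?_
    have h1 := hx i (mem_univ i)
    have h3 := hy i (mem_univ i)
    simp only [mem_Ico] at h1 h3
    apply sq_le_sq' <;> linarith
  have hr2 : (((n : ℝ) + 1) * 2 ^ k) ^ 2 ≤ r ^ 2 := by gcongr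
  have hn : (0 : ℝ) ≤ n := n.cast_nonneg
  simp only [Finset.sum_const, Finset.card_univ, Fintype.card_fin, nsmul_eq_mul] at hle
  change ∑ i, (y i - x i) ^ 2 < r ^ 2
  refine (hle.trans_lt ?_).trans_le hr2
  rw [mul_pow]
  gcongr
  nlinarith

theorem eBall_subset_closedBall {n : ℕ} (x : Fin n → ℝ) {r : ℝ} (hr : 0 ≤ r) :
    eBall x r ⊆ Metric.closedBall x r := by
  intro y hy
  rw [Metric.mem_closedBall, dist_pi_le_iff hr]
  intro i
  rw [Real.dist_eq]
  refine abs_le_of_sq_le_sq ?_ hr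
  exact (Finset.single_le_sum (f := fun i => (y i - x i) ^ 2) (fun i _ => sq_nonneg _)
    (Finset.mem_univ i)).trans (le_of_lt hy)

/-- The Whitney-type region in the upper half space above a dyadic cube. -/
def dyadicTent (n : ℕ) (Q : ℤ × (Fin n → ℤ)) : Set ((Fin n → ℝ) × ℝ) :=
  dyadicCube n Q.1 Q.2 ×ˢ Ico (((n : ℝ) + 1) * 2 ^ Q.1) (2 * (((n : ℝ) + 1) * 2 ^ Q.1))

theorem measurableSet_dyadicTent (n : ℕ) (Q : ℤ × (Fin n → ℤ)) :
    MeasurableSet (dyadicTent n Q) :=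
  (measurableSet_dyadicCube n Q.1 Q.2).prod measurableSet_Ico

theorem pairwise_disjoint_dyadicTent (n : ℕ) :
    Pairwise (Function.onFun Disjoint (dyadicTent n)) := by
  have key : ∀ {k k' : ℤ} {r : ℝ}, ((n : ℝ) + 1) * 2 ^ k ≤ r →
      r < 2 * (((n : ℝ) + 1) * 2 ^ k') → k ≤ k' := by
    intro k k' r h h'
    have h1 : ((n : ℝ) + 1) * 2 ^ k < ((n : ℝ) + 1) * 2 ^ (k' + 1) := by
      rw [zpow_add_one₀ two_ne_zero]
      linarith
    have h2 : (2 : ℝ) ^ k < 2 ^ (k' + 1) := lt_of_mul_lt_mul_left h1 (by positivity)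
    exact Int.lt_add_one_iff.1 ((zpow_lt_zpow_iff_right₀ one_lt_two).1 h2)
  intro Q Q' hne
  refine Set.disjoint_left.2 fun z hz hz' => hne ?_
  have hk : Q.1 = Q'.1 := le_antisymm (key hz.2.1 hz'.2.2) (key hz'.2.1 hz.2.2)
  refine Prod.ext hk ?_
  rw [eq_floor_of_mem_dyadicCube hz.1, eq_floor_of_mem_dyadicCube hz'.1, hk]

theorem le_nuP_dyadicTent (n : ℕ) {p : ℝ} (hp : 1 ≤ p) (Q : ℤ × (Fin n → ℤ)) :
    ENNReal.ofReal (((2 : ℝ) ^ Q.1) ^ (-p)) * volume (dyadicCube n Q.1 Q.2) ≤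
      ENNReal.ofReal ((2 * ((n : ℝ) + 1)) ^ (p + 1)) * nuP n p (dyadicTent n Q) := by
  set L : ℝ := 2 ^ Q.1 with hL
  have hLpos : 0 < L := by positivity
  set R : ℝ := (n : ℝ) + 1 with hR
  have hR1 : 1 ≤ R := by simp [hR]
  have hvol : (volume.prod volume) (dyadicTent n Q) =
      volume (dyadicCube n Q.1 Q.2) * ENNReal.ofReal (R * L) := by
    rw [dyadicTent, Measure.prod_prod, Real.volume_Ico]
    congr 2
    ring
  have hlow : ENNReal.ofReal ((2 * (R * L)) ^ (-(p + 1))) *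
      (volume (dyadicCube n Q.1 Q.2) * ENNReal.ofReal (R * L)) ≤ nuP n p (dyadicTent n Q) := by
    rw [nuP, withDensity_apply _ (measurableSet_dyadicTent n Q), ← hvol, ← setLIntegral_const]
    refine setLIntegral_mono' (measurableSet_dyadicTent n Q) fun z hz => ?_
    have hz1 : R * L ≤ z.2 := hz.2.1
    have hz2 : z.2 < 2 * (R * L) := hz.2.2
    have hz0 : 0 < z.2 := lt_of_lt_of_le (by positivity) hz1
    exact ENNReal.ofReal_le_ofReal (Real.rpow_le_rpow_of_nonpos hz0 hz2.le (by linarith))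
  refine le_trans ?_ (mul_le_mul_right hlow _)
  rw [mul_comm (volume _), ← mul_assoc, ← mul_assoc, ← ENNReal.ofReal_mul (by positivity),
    ← ENNReal.ofReal_mul (by positivity)]
  gcongr
  have h1 : (2 * (R * L)) ^ (-(p + 1)) = ((2 * R) ^ (p + 1))⁻¹ * (L ^ (-p) * L⁻¹) := by
    rw [← mul_assoc, Real.mul_rpow (by positivity) hLpos.le, Real.rpow_neg (by positivity),
      neg_add, Real.rpow_add hLpos, Real.rpow_neg_one]
  have h2 : (2 * R) ^ (p + 1) ≠ 0 := by positivity
  have h3 : (2 * R) ^ (p + 1) * (2 * (R * L)) ^ (-(p + 1)) * (R * L) = R * L ^ (-p) := by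
    rw [h1]
    field_simp
  rw [h3]
  exact le_mul_of_one_le_left (by positivity) hR1

theorem osc_dyadicCube_le {n : ℕ} {f : (Fin n → ℝ) → ℝ} (hf : LocallyIntegrable f volume)
    {Q : ℤ × (Fin n → ℤ)} {z : (Fin n → ℝ) × ℝ} (hz : z ∈ dyadicTent n Q) :
    osc f (dyadicCube n Q.1 Q.2) ≤ 2 * (4 * ((n : ℝ) + 1)) ^ n * osc f (eBall z.1 z.2) := by
  have hr0 : 0 ≤ z.2 := le_trans (by positivity) hz.2.1
  have hsub := eBall_subset_closedBall z.1 hr0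
  have hfin : volume (Metric.closedBall z.1 z.2) ≠ ∞ :=
    (isCompact_closedBall z.1 z.2).measure_lt_top.ne
  refine osc_le_of_subset (dyadicCube_subset_eBall hz.1 hz.2.1) ?_
    (measure_ne_top_of_subset hsub hfin) ?_
    ((hf.integrableOn_isCompact (isCompact_closedBall z.1 z.2)).mono_set hsub)
  · rw [volume_real_dyadicCube]
    positivity
  · calc volume.real (eBall z.1 z.2) ≤ volume.real (Metric.closedBall z.1 z.2) :=
          measureReal_mono hsub hfin
      _ = (2 * z.2) ^ n := by
          rw [measureReal_def, Real.volume_pi_closedBall _ hr0, Fintype.card_fin,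
            ENNReal.toReal_ofReal (by positivity)]
      _ ≤ (4 * ((n : ℝ) + 1) * 2 ^ Q.1) ^ n := by
          have := hz.2.2
          refine pow_le_pow_left₀ (by positivity) ?_ n
          linarith
      _ = _ := by rw [volume_real_dyadicCube, mul_pow]

/-- for `1 ≤ p < ∞` and `f ∈ L¹_loc(ℝⁿ)`, with `m(f)(x,r) = O(f,B(x,r))`,
one has `‖f‖_{𝒪^p(ℝⁿ)} ≲ ‖m(f)‖_{L^{p,∞}(ℝ^{n+1}_+, ν_p)}`. -/
theorem statement16 (n : ℕ) (p : ℝ) (hp : 1 ≤ p) :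
    ∃ C : ℝ, 0 < C ∧
      ∀ f : (Fin n → ℝ) → ℝ, LocallyIntegrable f volume →
      (⨆ l ∈ Set.Ioi (0 : ℝ), ENNReal.ofReal (l ^ p) *
          ∑' Q : ℤ × (Fin n → ℤ),
            if l < osc f (dyadicCube n Q.1 Q.2) then
              ENNReal.ofReal (((2 : ℝ) ^ Q.1) ^ (-p)) * volume (dyadicCube n Q.1 Q.2) else 0)
        ≤ ENNReal.ofReal C *
          ⨆ l ∈ Set.Ioi (0 : ℝ), ENNReal.ofReal (l ^ p) *
            nuP n p {z : (Fin n → ℝ) × ℝ | 0 < z.2 ∧ l < osc f (eBall z.1 z.2)} := by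
  set K : ℝ := 2 * (4 * ((n : ℝ) + 1)) ^ n with hKdef
  have hK : 0 < K := by positivity
  set D : ℝ := (2 * ((n : ℝ) + 1)) ^ (p + 1) with hDdef
  have hD : 0 < D := by positivity
  refine ⟨K ^ p * D, by positivity, fun f hf => iSup₂_le fun l hl => ?_⟩
  have hl0 : 0 < l := hl
  set U : ℝ → Set ((Fin n → ℝ) × ℝ) := fun t => {z | 0 < z.2 ∧ t < osc f (eBall z.1 z.2)} with hU
  let T : ℤ × (Fin n → ℤ) → Set ((Fin n → ℝ) × ℝ) := fun Q =>
    if l < osc f (dyadicCube n Q.1 Q.2) then dyadicTent n Q else ∅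
  have hTsub : ∀ Q, T Q ⊆ dyadicTent n Q := fun Q => by
    by_cases h : l < osc f (dyadicCube n Q.1 Q.2) <;> simp [T, h]
  have hTmeas : ∀ Q, MeasurableSet (T Q) := fun Q => by
    by_cases h : l < osc f (dyadicCube n Q.1 Q.2) <;> simp [T, h, measurableSet_dyadicTent]
  have hTdisj : Pairwise (Function.onFun Disjoint T) := fun Q Q' h =>
    (pairwise_disjoint_dyadicTent n h).mono (hTsub Q) (hTsub Q')
  have hTU : ⋃ Q, T Q ⊆ U (l / K) := by
    refine iUnion_subset fun Q z hz => ?_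
    by_cases h : l < osc f (dyadicCube n Q.1 Q.2)
    · have hz' := hTsub Q hz
      refine ⟨lt_of_lt_of_le (by positivity) hz'.2.1, ?_⟩
      rw [div_lt_iff₀ hK, mul_comm]
      exact h.trans_le (osc_dyadicCube_le hf hz')
    · simp [T, h] at hz
  have hsum : (∑' Q : ℤ × (Fin n → ℤ),
      if l < osc f (dyadicCube n Q.1 Q.2) then
        ENNReal.ofReal (((2 : ℝ) ^ Q.1) ^ (-p)) * volume (dyadicCube n Q.1 Q.2) else 0) ≤
      ENNReal.ofReal D * nuP n p (U (l / K)) := by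
    refine le_trans (ENNReal.tsum_le_tsum fun Q => ?_)
      ((ENNReal.tsum_mul_left (a := ENNReal.ofReal D) (f := fun Q => nuP n p (T Q))).trans_le ?_)
    · by_cases h : l < osc f (dyadicCube n Q.1 Q.2)
      · simpa only [T, h, if_true] using le_nuP_dyadicTent n hp Q
      · simp [h]
    · rw [← measure_iUnion hTdisj hTmeas]
      gcongr
  have hlp : l ^ p = K ^ p * (l / K) ^ p := by
    rw [← Real.mul_rpow hK.le (by positivity), mul_div_cancel₀ _ hK.ne']
  calc _ ≤ ENNReal.ofReal (l ^ p) * (ENNReal.ofReal D * nuP n p (U (l / K))) := by gcongr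
    _ = ENNReal.ofReal (K ^ p * D) *
        (ENNReal.ofReal ((l / K) ^ p) * nuP n p (U (l / K))) := by
      rw [hlp, ENNReal.ofReal_mul (by positivity), ENNReal.ofReal_mul (by positivity)]
      ring
    _ ≤ _ := by
      gcongr
      exact le_iSup₂_of_le (l / K) (mem_Ioi.2 (by positivity)) le_rfl
end
end

section
/- Let n ≥ 1 and 1 < p < ∞, and define f : ℝⁿ → ℝ by f = ∑_{k=1}^{∞} 2^{kn/p} χ_{[0,2^{−k}]ⁿ}. Then f ∈ L¹(ℝⁿ), f belongs to the dyadic John–Nirenberg space, i.e. ‖f‖_{JNₚ(ℝⁿ,𝒟)} < ∞, and yet, with b(f)_Q = ℓ(Q)^{n/p} O(f,Q), one has sup_{λ>0} λᵖ ∑_{Q∈𝒟 : b(f)_Q > λ} ℓ(Q)^{−n} |Q| = ∞. (Hence the embedding of JNₚ(ℝⁿ,𝒟) into 𝒪ᵖ_γ(ℝⁿ) fails for γ = n.) -/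
open MeasureTheory Set
open scoped ENNReal Classical

noncomputable section

/-- The function `f = ∑_{k=1}^∞ 2^{kn/p} χ_{[0,2^{-k}]ⁿ}` of Example 4. -/
def fExample (n : ℕ) (p : ℝ) : (Fin n → ℝ) → ℝ := fun x =>
  ∑' k : ℕ, ((2 : ℝ) ^ ((((k : ℝ) + 1) * n) / p)) *
    (Set.univ.pi fun _ : Fin n =>
      Set.Icc (0 : ℝ) ((2 : ℝ) ^ (-((k : ℝ) + 1)))).indicator (fun _ => (1 : ℝ)) x


theorem mem_dyadicCube_zero {n : ℕ} {k : ℤ} {x : Fin n → ℝ} :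
    x ∈ dyadicCube n k 0 ↔ ∀ i, 0 ≤ x i ∧ x i < 2 ^ k := by
  simp [dyadicCube, Set.mem_pi]

theorem dyadicCube_zero_mono {n : ℕ} {k l : ℤ} (h : k ≤ l) :
    dyadicCube n k 0 ⊆ dyadicCube n l 0 := fun x hx => by
  rw [mem_dyadicCube_zero] at hx ⊢
  exact fun i => ⟨(hx i).1, (hx i).2.trans_le (zpow_le_zpow_right₀ one_le_two h)⟩

theorem mem_dyadicCube_iff_floor {n : ℕ} {k : ℤ} {j : Fin n → ℤ} {x : Fin n → ℝ} :
    x ∈ dyadicCube n k j ↔ ∀ i, ⌊x i / 2 ^ k⌋ = j i := by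
  have h : (0 : ℝ) < 2 ^ k := by positivity
  simp [dyadicCube, Set.mem_pi, Int.floor_eq_iff, le_div_iff₀ h, div_lt_iff₀ h]

/-- Membership in a dyadic cube with corner at the origin is constant on every dyadic cube
whose corner is not at the origin. -/
theorem mem_dyadicCube_zero_iff_of_mem {n : ℕ} {k l : ℤ} {j : Fin n → ℤ} (hj : j ≠ 0)
    {x y : Fin n → ℝ} (hx : x ∈ dyadicCube n k j) (hy : y ∈ dyadicCube n k j) :
    x ∈ dyadicCube n l 0 ↔ y ∈ dyadicCube n l 0 := by
  rcases le_total k l with h | h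
  · obtain ⟨d, rfl⟩ := Int.le.dest h
    have hk : (0 : ℝ) < 2 ^ k := by positivity
    have key {z : Fin n → ℝ} (hz : z ∈ dyadicCube n k j) :
        z ∈ dyadicCube n (k + d) 0 ↔ ∀ i, 0 ≤ j i ∧ j i < 2 ^ d := by
      rw [mem_dyadicCube_zero]
      refine forall_congr' fun i => ?_
      rw [← mem_dyadicCube_iff_floor.1 hz i, Int.floor_nonneg, Int.floor_lt, le_div_iff₀ hk,
        div_lt_iff₀ hk, zpow_add₀ two_ne_zero, zero_mul, mul_comm]
      simp
    rw [key hx, key hy]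
  · have key {z : Fin n → ℝ} (hz : z ∈ dyadicCube n k j) : z ∉ dyadicCube n l 0 := fun hz' =>
      hj <| funext fun i => by
        rw [← mem_dyadicCube_iff_floor.1 hz i,
          mem_dyadicCube_iff_floor.1 (dyadicCube_zero_mono h hz') i]
    simp [key hx, key hy]

/-- The function `∑_{k ≥ 1} 2^{kn/p} χ_{[0,2^{-k})ⁿ}`. -/
def dyadicSeries (n : ℕ) (p : ℝ) : (Fin n → ℝ) → ℝ := fun x =>
  ∑' k : ℕ, ((2 : ℝ) ^ ((((k : ℝ) + 1) * n) / p)) *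
    (dyadicCube n (-((k : ℤ) + 1)) 0).indicator (fun _ => (1 : ℝ)) x

theorem fExample_ae_eq_dyadicSeries (n : ℕ) (p : ℝ) :
    fExample n p =ᵐ[volume] dyadicSeries n p := by
  have h (k : ℕ) : (Set.univ.pi fun _ : Fin n => Set.Icc (0 : ℝ) ((2 : ℝ) ^ (-((k : ℝ) + 1))))
      =ᵐ[volume] dyadicCube n (-((k : ℤ) + 1)) 0 := by
    have := (Measure.univ_pi_Ico_ae_eq_Icc (μ := fun _ : Fin n => (volume : Measure ℝ))
      (f := fun _ => 0) (g := fun _ => (2 : ℝ) ^ (-((k : ℝ) + 1)))).symm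
    rw [← Set.pi_univ_Icc] at this
    convert this using 2
    simp only [dyadicCube, Pi.zero_apply, Int.cast_zero, zero_mul, zero_add, one_mul]
    rw [← Real.rpow_intCast]
    push_cast
    rfl
  have h' := ae_all_iff.2 fun k => indicator_ae_eq_of_ae_eq_set (f := fun _ => (1 : ℝ)) (h k)
  filter_upwards [h'] with x hx
  exact tsum_congr fun k => by rw [hx k]

theorem osc_congr {n : ℕ} {f g : (Fin n → ℝ) → ℝ} {E : Set (Fin n → ℝ)}
    (h : f =ᵐ[volume.restrict E] g) : osc f E = osc g E := by
  unfold osc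
  rw [average_congr h]
  exact average_congr (h.mono fun x hx => by simp only [hx])

theorem osc_nonneg {n : ℕ} (f : (Fin n → ℝ) → ℝ) (E : Set (Fin n → ℝ)) : 0 ≤ osc f E := by
  rw [osc, setAverage_eq]
  exact smul_nonneg (by positivity) (integral_nonneg fun _ => abs_nonneg _)

theorem dyadicSeries_eq_of_mem {n : ℕ} (p : ℝ) {k : ℤ} {j : Fin n → ℤ} (hj : j ≠ 0)
    {x y : Fin n → ℝ} (hx : x ∈ dyadicCube n k j) (hy : y ∈ dyadicCube n k j) :
    dyadicSeries n p x = dyadicSeries n p y :=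
  tsum_congr fun _ => by simp only [Set.indicator, mem_dyadicCube_zero_iff_of_mem hj hx hy]

theorem volume_dyadicCube_ne_zero (n : ℕ) (k : ℤ) (j : Fin n → ℤ) :
    volume (dyadicCube n k j) ≠ 0 := by
  rw [volume_dyadicCube]
  exact (ENNReal.ofReal_pos.2 (by positivity)).ne'

theorem volume_dyadicCube_ne_top (n : ℕ) (k : ℤ) (j : Fin n → ℤ) :
    volume (dyadicCube n k j) ≠ ⊤ := by
  rw [volume_dyadicCube]
  exact ENNReal.ofReal_ne_top

theorem osc_eq_zero_of_forall_eq {n : ℕ} {f : (Fin n → ℝ) → ℝ} {E : Set (Fin n → ℝ)}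
    (hE : MeasurableSet E) (h₀ : volume E ≠ 0) (h₁ : volume E ≠ ⊤)
    (h : ∀ x ∈ E, ∀ y ∈ E, f x = f y) : osc f E = 0 := by
  obtain ⟨z, hz⟩ := nonempty_of_measure_ne_zero h₀
  have hav : ⨍ y in E, f y = f z := by
    rw [setAverage_congr_fun hE (.of_forall fun y hy => h y hy z hz), setAverage_const h₀ h₁]
  rw [osc, hav, setAverage_congr_fun hE (g := fun _ => 0)
    (.of_forall fun y hy => by rw [h y hy z hz, sub_self, abs_zero]), setAverage_const h₀ h₁]

theorem osc_dyadicSeries_of_ne_zero {n : ℕ} (p : ℝ) (k : ℤ) {j : Fin n → ℤ} (hj : j ≠ 0) :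
    osc (dyadicSeries n p) (dyadicCube n k j) = 0 :=
  osc_eq_zero_of_forall_eq (measurableSet_dyadicCube n k j) (volume_dyadicCube_ne_zero n k j)
    (volume_dyadicCube_ne_top n k j) fun _ hx _ hy => dyadicSeries_eq_of_mem p hj hx hy

/-- Mean oscillation is at most `2 ‖f‖₁ / |E|`. -/
theorem osc_le {n : ℕ} {f : (Fin n → ℝ) → ℝ} {E : Set (Fin n → ℝ)}
    (hf : Integrable f) (h₀ : volume E ≠ 0) (h₁ : volume E ≠ ⊤) :
    osc f E ≤ (volume.real E)⁻¹ * (2 * ∫ x, |f x|) := by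
  have hE : 0 < volume.real E := ENNReal.toReal_pos h₀ h₁
  have : IsFiniteMeasure (volume.restrict E) := ⟨by simpa using h₁.lt_top⟩
  have hle : ∫ x in E, |f x| ≤ ∫ x, |f x| :=
    setIntegral_le_integral hf.abs (.of_forall fun _ => abs_nonneg _)
  rw [osc, setAverage_eq, smul_eq_mul]
  gcongr
  set a := ⨍ y in E, f y with ha
  have h2 : volume.real E * |a| ≤ ∫ x in E, |f x| := by
    rw [ha, setAverage_eq, smul_eq_mul, abs_mul, abs_of_pos (inv_pos.2 hE),
      mul_inv_cancel_left₀ hE.ne']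
    exact abs_integral_le_integral_abs
  calc ∫ x in E, |f x - a| ≤ ∫ x in E, (|f x| + |a|) :=
        integral_mono (hf.integrableOn.sub (integrable_const a)).abs
          (hf.integrableOn.abs.add (integrable_const _)) fun x => abs_sub _ _
    _ = (∫ x in E, |f x|) + volume.real E * |a| := by
        rw [integral_add hf.integrableOn.abs (integrable_const _)]
        simp [measureReal_def]
    _ ≤ 2 * ∫ x, |f x| := by linarith

theorem integrable_dyadicSeries {n : ℕ} (hn : 1 ≤ n) {p : ℝ} (hp : 1 < p) :
    Integrable (dyadicSeries n p) := by
  have hmeas (k : ℕ) : Measurable fun x => ((2 : ℝ) ^ ((((k : ℝ) + 1) * n) / p)) *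
      (dyadicCube n (-((k : ℤ) + 1)) 0).indicator (fun _ => (1 : ℝ)) x :=
    (measurable_const.indicator (measurableSet_dyadicCube _ _ _)).const_mul _
  refine ⟨(Measurable.tsum hmeas).aestronglyMeasurable, ?_⟩
  have hterm (k : ℕ) : ∫⁻ x, ‖((2 : ℝ) ^ ((((k : ℝ) + 1) * n) / p)) *
      (dyadicCube n (-((k : ℤ) + 1)) 0).indicator (fun _ => (1 : ℝ)) x‖ₑ =
      ENNReal.ofReal ((2 : ℝ) ^ ((n : ℝ) / p - n)) ^ (k + 1) := by
    simp_rw [enorm_mul, enorm_indicator_eq_indicator_enorm]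
    rw [lintegral_const_mul _ (measurable_const.indicator (measurableSet_dyadicCube _ _ _)),
      lintegral_indicator_const (measurableSet_dyadicCube _ _ _), volume_dyadicCube, enorm_one,
      one_mul, Real.enorm_of_nonneg (by positivity), ← ENNReal.ofReal_mul (by positivity),
      ← ENNReal.ofReal_pow (by positivity)]
    congr 1
    rw [← Real.rpow_intCast, ← Real.rpow_natCast, ← Real.rpow_natCast, ← Real.rpow_mul zero_le_two,
      ← Real.rpow_mul zero_le_two, ← Real.rpow_add zero_lt_two]
    push_cast
    ring_nf
  have hlt : ENNReal.ofReal ((2 : ℝ) ^ ((n : ℝ) / p - n)) < 1 := by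
    rw [ENNReal.ofReal_lt_one]
    refine Real.rpow_lt_one_of_one_lt_of_neg one_lt_two (sub_neg.2 (div_lt_self ?_ hp))
    exact_mod_cast hn
  calc ∫⁻ x, ‖dyadicSeries n p x‖ₑ ≤ ∫⁻ x, ∑' k : ℕ, ‖((2 : ℝ) ^ ((((k : ℝ) + 1) * n) / p)) *
        (dyadicCube n (-((k : ℤ) + 1)) 0).indicator (fun _ => (1 : ℝ)) x‖ₑ :=
        lintegral_mono fun x => enorm_tsum_le_tsum_enorm
    _ = ∑' k : ℕ, ENNReal.ofReal ((2 : ℝ) ^ ((n : ℝ) / p - n)) ^ (k + 1) := by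
        rw [lintegral_tsum fun k => (hmeas k).enorm.aemeasurable]
        exact tsum_congr hterm
    _ < ⊤ := by
        rw [ENNReal.tsum_geometric_add_one]
        exact ENNReal.mul_lt_top ENNReal.ofReal_lt_top
          (ENNReal.inv_lt_top.2 (tsub_pos_of_lt hlt))

open scoped Pointwise in
theorem setAverage_comp_smul {n : ℕ} (f : (Fin n → ℝ) → ℝ) {R : ℝ} (hR : 0 < R)
    (E : Set (Fin n → ℝ)) : ⨍ x in E, f (R • x) = ⨍ x in R • E, f x := by
  rw [setAverage_eq, setAverage_eq, Measure.setIntegral_comp_smul_of_pos _ _ _ hR,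
    measureReal_def, measureReal_def, Measure.addHaar_smul]
  simp [abs_of_pos hR, hR.le, mul_assoc, mul_left_comm, mul_comm]

open scoped Pointwise in
theorem osc_comp_smul {n : ℕ} (f : (Fin n → ℝ) → ℝ) {R : ℝ} (hR : 0 < R)
    (E : Set (Fin n → ℝ)) : osc (fun x => f (R • x)) E = osc f (R • E) := by
  rw [osc, osc, setAverage_comp_smul f hR,
    setAverage_comp_smul (fun x => |f x - ⨍ y in R • E, f y|) hR]

theorem osc_const_mul_const_add {n : ℕ} {f : (Fin n → ℝ) → ℝ} (c d : ℝ) {E : Set (Fin n → ℝ)}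
    (hf : IntegrableOn f E) (h₀ : volume E ≠ 0) (h₁ : volume E ≠ ⊤) :
    osc (fun x => c * (d + f x)) E = |c| * osc f E := by
  have : IsFiniteMeasure (volume.restrict E) := ⟨by simpa using h₁.lt_top⟩
  have hE : 0 < volume.real E := ENNReal.toReal_pos h₀ h₁
  have hav : ⨍ x in E, c * (d + f x) = c * (d + ⨍ x in E, f x) := by
    rw [setAverage_eq, setAverage_eq, integral_const_mul,
      integral_add (integrable_const _) hf.integrable]
    simp only [integral_const, smul_eq_mul, measureReal_restrict_apply_univ]
    field_simp
  rw [osc, hav, osc]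
  set a := ⨍ x in E, f x
  have habs (x : Fin n → ℝ) : |c * (d + f x) - c * (d + a)| = |c| * |f x - a| := by
    rw [← abs_mul]
    ring_nf
  simp only [habs, setAverage_eq, smul_eq_mul, integral_const_mul]
  ring

theorem summable_dyadicSeries (n : ℕ) (p : ℝ) {x : Fin n → ℝ} (hx : x ≠ 0) :
    Summable fun k : ℕ => ((2 : ℝ) ^ ((((k : ℝ) + 1) * n) / p)) *
      (dyadicCube n (-((k : ℤ) + 1)) 0).indicator (fun _ => (1 : ℝ)) x := by
  obtain ⟨i, hi⟩ := Function.ne_iff.1 hx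
  obtain ⟨K, hK⟩ := exists_pow_lt_of_lt_one (abs_pos.2 hi) (one_half_lt_one (α := ℝ))
  refine summable_of_ne_finset_zero (s := Finset.range K) fun k hk => ?_
  rw [Set.indicator_of_notMem, mul_zero]
  intro h
  obtain ⟨h0, h1⟩ := mem_dyadicCube_zero.1 h i
  rw [abs_of_nonneg h0] at hK
  refine absurd (hK.trans h1) (not_lt.2 ?_)
  rw [one_div, inv_pow, ← zpow_natCast, ← zpow_neg]
  refine zpow_le_zpow_right₀ one_le_two ?_
  have := Finset.mem_range.not.1 hk
  lia

theorem inv_two_smul_mem_dyadicCube_zero {n : ℕ} {k : ℤ} {x : Fin n → ℝ} :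
    (2⁻¹ : ℝ) • x ∈ dyadicCube n (k - 1) 0 ↔ x ∈ dyadicCube n k 0 := by
  simp only [mem_dyadicCube_zero, Pi.smul_apply, smul_eq_mul, zpow_sub_one₀ (two_ne_zero' ℝ)]
  refine forall_congr' fun i => and_congr ?_ ?_ <;> constructor <;> intro h <;> linarith

open scoped Pointwise in
theorem inv_two_smul_dyadicCube_zero (n : ℕ) (k : ℤ) :
    (2⁻¹ : ℝ) • dyadicCube n k 0 = dyadicCube n (k - 1) 0 := by
  ext x
  rw [Set.mem_smul_set_iff_inv_smul_mem₀ (by norm_num), ← inv_two_smul_mem_dyadicCube_zero,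
    smul_inv_smul₀ (by norm_num)]

theorem dyadicSeries_inv_two_smul {n : ℕ} (p : ℝ) {x : Fin n → ℝ} (hx : x ≠ 0)
    (hx' : x ∈ dyadicCube n 0 0) :
    dyadicSeries n p ((2⁻¹ : ℝ) • x) = (2 : ℝ) ^ ((n : ℝ) / p) * (1 + dyadicSeries n p x) := by
  rw [dyadicSeries, (summable_dyadicSeries n p (smul_ne_zero (by norm_num) hx)).tsum_eq_zero_add,
    dyadicSeries, mul_add, ← tsum_mul_left]
  have hmem (k : ℤ) : (2⁻¹ : ℝ) • x ∈ dyadicCube n (-(k + 1)) 0 ↔ x ∈ dyadicCube n (-k) 0 := by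
    rw [neg_add', inv_two_smul_mem_dyadicCube_zero]
  congr 1
  · simp only [Set.indicator, hmem]
    simp [hx']
  · refine tsum_congr fun k => ?_
    simp only [Set.indicator, hmem, ← mul_assoc]
    rw [← Real.rpow_add zero_lt_two]
    push_cast
    ring_nf

theorem osc_dyadicSeries_sub_one {n : ℕ} (hn : 1 ≤ n) {p : ℝ} (hp : 1 < p) {k : ℤ}
    (hk : k ≤ 0) : osc (dyadicSeries n p) (dyadicCube n (k - 1) 0) =
      (2 : ℝ) ^ ((n : ℝ) / p) * osc (dyadicSeries n p) (dyadicCube n k 0) := by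
  have : Nonempty (Fin n) := ⟨⟨0, hn⟩⟩
  have h0 : ∀ᵐ x : Fin n → ℝ, x ≠ 0 := compl_mem_ae_iff.2 (measure_singleton 0)
  rw [← inv_two_smul_dyadicCube_zero, ← osc_comp_smul _ (by norm_num),
    osc_congr (g := fun x => (2 : ℝ) ^ ((n : ℝ) / p) * (1 + dyadicSeries n p x)),
    osc_const_mul_const_add _ _ (integrable_dyadicSeries hn hp).integrableOn
      (volume_dyadicCube_ne_zero n k 0) (volume_dyadicCube_ne_top n k 0),
    abs_of_pos (by positivity)]
  refine (ae_restrict_iff' (measurableSet_dyadicCube n k 0)).2 (h0.mono fun x hx hxk => ?_)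
  exact dyadicSeries_inv_two_smul p hx (dyadicCube_zero_mono hk hxk)

theorem osc_dyadicSeries_neg_natCast {n : ℕ} (hn : 1 ≤ n) {p : ℝ} (hp : 1 < p) (m : ℕ) :
    osc (dyadicSeries n p) (dyadicCube n (-(m : ℤ)) 0) =
      ((2 : ℝ) ^ ((n : ℝ) / p)) ^ m * osc (dyadicSeries n p) (dyadicCube n 0 0) := by
  induction m with
  | zero => simp
  | succ m ih =>
    rw [Nat.cast_succ, neg_add', osc_dyadicSeries_sub_one hn hp (by lia), ih, pow_succ']
    ring

theorem rpow_sidelength_mul_osc_dyadicSeries {n : ℕ} (hn : 1 ≤ n) {p : ℝ} (hp : 1 < p) (m : ℕ) :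
    ((2 : ℝ) ^ (-(m : ℤ))) ^ ((n : ℝ) / p) *
      osc (dyadicSeries n p) (dyadicCube n (-(m : ℤ)) 0) =
        osc (dyadicSeries n p) (dyadicCube n 0 0) := by
  rw [osc_dyadicSeries_neg_natCast hn hp, ← mul_assoc, ← Real.rpow_intCast, ← Real.rpow_natCast,
    ← Real.rpow_mul zero_le_two, ← Real.rpow_mul zero_le_two, ← Real.rpow_add zero_lt_two]
  push_cast
  ring_nf
  simp

theorem exists_mem_dyadicCube_sub_one_compl {n : ℕ} (hn : 1 ≤ n) (k : ℤ)
    {s : (Fin n → ℝ) → Prop} (hs : ∀ᵐ x, x ∈ dyadicCube n k 0 → s x) :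
    ∃ x ∈ dyadicCube n k 0, x ∉ dyadicCube n (k - 1) 0 ∧ s x := by
  by_contra! h
  have hle : volume (dyadicCube n k 0) ≤ volume (dyadicCube n (k - 1) 0) :=
    measure_mono_ae (hs.mono fun x hx hxk => by_contra fun hx' => h x hxk hx' (hx hxk))
  rw [volume_dyadicCube, volume_dyadicCube, ENNReal.ofReal_le_ofReal_iff (by positivity)] at hle
  refine absurd hle (not_le.2 (pow_lt_pow_left₀ ?_ (by positivity) (by lia)))
  exact zpow_lt_zpow_right₀ one_lt_two (by lia)

theorem osc_dyadicSeries_pos {n : ℕ} (hn : 1 ≤ n) {p : ℝ} (hp : 1 < p) :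
    0 < osc (dyadicSeries n p) (dyadicCube n 0 0) := by
  refine (osc_nonneg _ _).lt_of_ne' fun h => ?_
  have : IsFiniteMeasure (volume.restrict (dyadicCube n 0 0)) :=
    ⟨by simpa using (volume_dyadicCube_ne_top n 0 0).lt_top⟩
  set a := ⨍ x in dyadicCube n 0 0, dyadicSeries n p x with ha
  have hvol : volume.real (dyadicCube n 0 0) ≠ 0 :=
    (ENNReal.toReal_pos (volume_dyadicCube_ne_zero n 0 0) (volume_dyadicCube_ne_top n 0 0)).ne'
  have hint : IntegrableOn (fun x => |dyadicSeries n p x - a|) (dyadicCube n 0 0) :=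
    ((integrable_dyadicSeries hn hp).integrableOn.sub (integrable_const a)).abs
  rw [osc, ← ha, setAverage_eq, smul_eq_mul, mul_eq_zero_iff_left (inv_ne_zero hvol),
    integral_eq_zero_iff_of_nonneg (fun _ => abs_nonneg _) hint] at h
  have hae : ∀ᵐ x, x ∈ dyadicCube n 0 0 → dyadicSeries n p x = a :=
    (ae_restrict_iff' (measurableSet_dyadicCube n 0 0)).1 <| h.mono fun x hx => by
      simpa [sub_eq_zero] using hx
  obtain ⟨x, -, hx, hxa⟩ := exists_mem_dyadicCube_sub_one_compl hn 0 hae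
  obtain ⟨y, hy, hy', hya⟩ := exists_mem_dyadicCube_sub_one_compl hn (-1)
    (hae.mono fun y hy hy1 => hy (dyadicCube_zero_mono (by lia) hy1))
  have hx0 : dyadicSeries n p x = 0 := by
    rw [dyadicSeries, tsum_congr (g := fun _ => (0 : ℝ)), tsum_zero]
    intro k
    rw [Set.indicator_of_notMem fun h => hx (dyadicCube_zero_mono (by lia) h), mul_zero]
  have hy0 : dyadicSeries n p y = (2 : ℝ) ^ ((n : ℝ) / p) := by
    rw [dyadicSeries, tsum_eq_single 0]
    · simp [hy]
    · intro k hk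
      rw [Set.indicator_of_notMem fun h => hy' (dyadicCube_zero_mono (by lia) h), mul_zero]
  have : (0 : ℝ) < 2 ^ ((n : ℝ) / p) := by positivity
  linarith

/-- `|Q| O(f,Q)^p` is bounded uniformly over all dyadic cubes `Q` with corner at the origin. -/
theorem volume_mul_osc_dyadicSeries_rpow_le {n : ℕ} (hn : 1 ≤ n) {p : ℝ} (hp : 1 < p) (k : ℤ) :
    volume (dyadicCube n k 0) *
      ENNReal.ofReal (osc (dyadicSeries n p) (dyadicCube n k 0) ^ p) ≤
        ENNReal.ofReal ((2 * ∫ x, |dyadicSeries n p x|) ^ p) := by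
  have hp0 : 0 < p := one_pos.trans hp
  have hle (k : ℤ) : osc (dyadicSeries n p) (dyadicCube n k 0) ≤
      (((2 : ℝ) ^ k) ^ n)⁻¹ * (2 * ∫ x, |dyadicSeries n p x|) := by
    have := osc_le (integrable_dyadicSeries hn hp) (volume_dyadicCube_ne_zero n k 0)
      (volume_dyadicCube_ne_top n k 0)
    rwa [measureReal_def, volume_dyadicCube, ENNReal.toReal_ofReal (by positivity)] at this
  have hC : 0 ≤ 2 * ∫ x, |dyadicSeries n p x| :=
    mul_nonneg zero_le_two (integral_nonneg fun _ => abs_nonneg _)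
  rw [volume_dyadicCube, ← ENNReal.ofReal_mul (by positivity)]
  refine ENNReal.ofReal_le_ofReal ?_
  have hnn := osc_nonneg (dyadicSeries n p) (dyadicCube n k 0)
  rcases le_total k 0 with hk | hk
  · obtain ⟨m, rfl⟩ := Int.exists_eq_neg_ofNat hk
    have key : ((2 : ℝ) ^ (-(m : ℤ))) ^ n = (((2 : ℝ) ^ (-(m : ℤ))) ^ ((n : ℝ) / p)) ^ p := by
      rw [← Real.rpow_mul (by positivity), div_mul_cancel₀ _ hp0.ne', Real.rpow_natCast]
    rw [key, ← Real.mul_rpow (by positivity) hnn, rpow_sidelength_mul_osc_dyadicSeries hn hp]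
    exact Real.rpow_le_rpow (osc_nonneg _ _) (by simpa using hle 0) hp0.le
  · have h1 : 1 ≤ ((2 : ℝ) ^ k) ^ n := one_le_pow₀ (one_le_zpow₀ one_le_two hk)
    set V := ((2 : ℝ) ^ k) ^ n
    calc V * osc (dyadicSeries n p) (dyadicCube n k 0) ^ p
        ≤ V ^ p * osc (dyadicSeries n p) (dyadicCube n k 0) ^ p := by
          gcongr
          exact Real.self_le_rpow_of_one_le h1 hp.le
      _ = (V * osc (dyadicSeries n p) (dyadicCube n k 0)) ^ p :=
          (Real.mul_rpow (by positivity) hnn).symm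
      _ ≤ _ := by
          refine Real.rpow_le_rpow (by positivity) ?_ hp0.le
          exact (le_inv_mul_iff₀ (by positivity)).1 (hle k)

/-- for `n ≥ 1` and `1 < p < ∞`, the function
`f = ∑_{k≥1} 2^{kn/p} χ_{[0,2^{-k}]ⁿ}` is in `L¹(ℝⁿ)`, has finite dyadic
John–Nirenberg norm `‖f‖_{JN_p(ℝⁿ,𝒟)}`, and yet, with `b(f)_Q = ℓ(Q)^{n/p} O(f,Q)`,
`sup_{λ>0} λ^p ∑_{b(f)_Q>λ} ℓ(Q)^{-n} |Q| = ∞`. -/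
theorem statement19 (n : ℕ) (hn : 1 ≤ n) (p : ℝ) (hp : 1 < p) :
    Integrable (fExample n p) volume ∧
    (⨆ (P : Set (ℤ × (Fin n → ℤ)))
        (_ : P.PairwiseDisjoint fun Q => dyadicCube n Q.1 Q.2),
        ∑' Q : ℤ × (Fin n → ℤ),
          if Q ∈ P then
            volume (dyadicCube n Q.1 Q.2) *
              ENNReal.ofReal (osc (fExample n p) (dyadicCube n Q.1 Q.2) ^ p) else 0) < ⊤ ∧
    (⨆ l ∈ Set.Ioi (0 : ℝ), ENNReal.ofReal (l ^ p) *
        ∑' Q : ℤ × (Fin n → ℤ),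
          if l < ((2 : ℝ) ^ Q.1) ^ ((n : ℝ) / p) * osc (fExample n p) (dyadicCube n Q.1 Q.2)
          then ENNReal.ofReal (((2 : ℝ) ^ Q.1) ^ (-(n : ℝ))) * volume (dyadicCube n Q.1 Q.2)
          else 0) = ⊤ := by
  have hp0 : 0 < p := one_pos.trans hp
  have hosc (k : ℤ) (j : Fin n → ℤ) : osc (fExample n p) (dyadicCube n k j) =
      osc (dyadicSeries n p) (dyadicCube n k j) :=
    osc_congr (ae_restrict_of_ae (fExample_ae_eq_dyadicSeries n p))
  simp only [hosc]
  refine ⟨(integrable_dyadicSeries hn hp).congr (fExample_ae_eq_dyadicSeries n p).symm, ?_, ?_⟩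
  · refine lt_of_le_of_lt (iSup₂_le fun P hP => ?_)
      (ENNReal.ofReal_lt_top (r := (2 * ∫ x, |dyadicSeries n p x|) ^ p))
    have hzero (k : ℤ) {j : Fin n → ℤ} (hj : j ≠ 0) : volume (dyadicCube n k j) *
        ENNReal.ofReal (osc (dyadicSeries n p) (dyadicCube n k j) ^ p) = 0 := by
      simp [osc_dyadicSeries_of_ne_zero p k hj, Real.zero_rpow hp0.ne']
    by_cases h : ∃ k, ((k, 0) : ℤ × (Fin n → ℤ)) ∈ P
    · obtain ⟨k, hk⟩ := h
      rw [tsum_eq_single (k, 0), if_pos hk]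
      · exact volume_mul_osc_dyadicSeries_rpow_le hn hp k
      · rintro ⟨l, j⟩ hne
        refine ite_eq_right_iff.2 fun hl => ?_
        by_cases hj : j = 0
        · subst hj
          have h0 (i : ℤ) : (0 : Fin n → ℝ) ∈ dyadicCube n i 0 :=
            mem_dyadicCube_zero.2 fun _ => ⟨le_rfl, by simp; positivity⟩
          exact absurd (h0 k) (Set.disjoint_left.1 (hP hl hk hne) (h0 l))
        · exact hzero l hj
    · rw [ENNReal.tsum_eq_zero.2]
      · exact zero_le
      rintro ⟨l, j⟩
      refine ite_eq_right_iff.2 fun hl => hzero l ?_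
      rintro rfl
      exact h ⟨l, hl⟩
  · have hb := osc_dyadicSeries_pos hn hp
    set b := osc (dyadicSeries n p) (dyadicCube n 0 0)
    refine top_le_iff.1 (le_trans (top_le_iff.2 ?_) (le_iSup₂ (b / 2) (half_pos hb)))
    refine ENNReal.mul_eq_top.2 (.inl ⟨(ENNReal.ofReal_pos.2 (by positivity)).ne', ?_⟩)
    have hinj : Function.Injective fun m : ℕ => ((-(m : ℤ), 0) : ℤ × (Fin n → ℤ)) :=
      fun m m' h => by simpa using h
    refine top_le_iff.1 (le_trans ?_ (ENNReal.tsum_comp_le_tsum_of_injective hinj _))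
    rw [← ENNReal.tsum_const_eq_top_of_ne_zero (α := ℕ) one_ne_zero]
    refine ENNReal.tsum_le_tsum fun m => ?_
    simp only
    rw [rpow_sidelength_mul_osc_dyadicSeries hn hp, if_pos (half_lt_self hb), volume_dyadicCube,
      ← ENNReal.ofReal_mul (by positivity), Real.rpow_neg (by positivity), Real.rpow_natCast,
      inv_mul_cancel₀ (by positivity), ENNReal.ofReal_one]
end
end
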